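/- Let u, f : ℝ → ℝ be smooth functions such that f''' + 4·u·f' + 2·u'·f = 0 holds at every point of ℝ. Then the function x ↦ f(x)·f''(x) + 2·u(x)·f(x)² − (1/2)·f'(x)² is constant on ℝ; i.e., there exists c ∈ ℝ with f·f'' + 2·u·f² − (1/2)·(f')² = c everywhere. -/

import Mathlib

/-- If smooth `u, f : ℝ → ℝ` satisfy the projective vector field equation
`f''' + 4·u·f' + 2·u'·f = 0` everywhere, then `f·f'' + 2·u·f² − (1/2)·(f')²` is constant. -/
theorem stmt_0 (u f : ℝ → ℝ) (hu : ContDiff ℝ (⊤ : ℕ∞) u) (hf : ContDiff ℝ (⊤ : ℕ∞) f)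
    (hproj : ∀ x : ℝ,
      iteratedDeriv 3 f x + 4 * u x * deriv f x + 2 * deriv u x * f x = 0) :
    ∃ c : ℝ, ∀ x : ℝ,
      f x * iteratedDeriv 2 f x + 2 * u x * (f x) ^ 2
        - (1 / 2) * (deriv f x) ^ 2 = c := by
  have hder (n : ℕ) (x : ℝ) :
      HasDerivAt (iteratedDeriv n f) (iteratedDeriv (n + 1) f x) x := by
    rw [iteratedDeriv_succ]
    exact (hf.differentiable_iteratedDeriv n (by exact_mod_cast WithTop.coe_lt_top n) x).hasDerivAt
  have hd0 (x : ℝ) : HasDerivAt f (deriv f x) x := by simpa using hder 0 x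
  have hd1 (x : ℝ) : HasDerivAt (deriv f) (iteratedDeriv 2 f x) x := by
    simpa only [iteratedDeriv_one] using hder 1 x
  have hdu (x : ℝ) : HasDerivAt u (deriv u x) x :=
    (hu.differentiable (by simp) x).hasDerivAt
  have hconst (x : ℝ) : HasDerivAt (fun y => f y * iteratedDeriv 2 f y + 2 * u y * (f y) ^ 2
      - (1 / 2) * (deriv f y) ^ 2) 0 x := by
    refine ((((hd0 x).fun_mul (hder 2 x)).fun_add
      (((hdu x).const_mul 2).fun_mul ((hd0 x).fun_pow 2))).fun_sub
      (((hd1 x).fun_pow 2).const_mul (1 / 2))).congr_deriv ?_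
    norm_num
    linear_combination f x * hproj x
  exact ⟨_, fun x => is_const_of_deriv_eq_zero (fun y => (hconst y).differentiableAt)
    (fun y => (hconst y).deriv) x 0⟩
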